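/- Strict monotonicity of thresholds in the leader-of-mediocre probability for non-comparable agents (Lemma 4): let r be an equilibrium threshold profile and let i, j be distinct agents such that neither i leads j nor j leads i. If p_i^lom < p_j^lom, then r_i < r_j. -/

import Mathlib

open Finset

/-- `x` leads `y` (with requester `p`): `x ≠ y` and every walk from `p` to `y` contains `x`
in its support. -/
def Leads {V : Type*} (H : SimpleGraph V) (p x y : V) : Prop :=
  x ≠ y ∧ ∀ w : H.Walk p y, x ∈ w.support

variable {V : Type*} [Fintype V] [DecidableEq V]

/-- The agents: all vertices other than the requester `p`. -/
def agents (p : V) : Finset V := Finset.univ.filter (· ≠ p)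

/-- `Dset H p i`: the set of agents led by `i`. -/
noncomputable def Dset (H : SimpleGraph V) (p i : V) : Finset V :=
  @Finset.filter _ (fun j => Leads H p i j) (Classical.decPred _) (agents p)

/-- `Pset H p i`: the competitors of `i`, namely `U \ (D_i ∪ {i})`. -/
noncomputable def Pset (H : SimpleGraph V) (p i : V) : Finset V :=
  agents p \ insert i (Dset H p i)

/-- Agent `i`'s expected utility for contributing with ability `q`:
`π_i(q) = M * ∏_{j ∈ P_i} F (max (r j) q) - c`. -/
noncomputable def piU (H : SimpleGraph V) (p : V) (c M : ℝ) (F : ℝ → ℝ)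
    (r : V → ℝ) (i : V) (q : ℝ) : ℝ :=
  M * (∏ j ∈ Pset H p i, F (max (r j) q)) - c

/-- `r` is an equilibrium threshold profile: every threshold lies in `[l,u]`, every agent has
strictly positive utility for contributing with any ability strictly above her threshold, and
each threshold is either `l` or gives nonpositive utility. -/
def IsEqm (H : SimpleGraph V) (p : V) (l u c M : ℝ) (F : ℝ → ℝ) (r : V → ℝ) : Prop :=
  (∀ i ∈ agents p, r i ∈ Set.Icc l u) ∧
  (∀ i ∈ agents p, ∀ q ∈ Set.Ioc (r i) u, 0 < piU H p c M F r i q) ∧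
  (∀ i ∈ agents p, r i = l ∨ piU H p c M F r i (r i) ≤ 0)

/-- The leader-of-mediocre probability `p_i^lom = ∏_{k ∈ D_i} F (r k)`. -/
noncomputable def lom (H : SimpleGraph V) (p : V) (F : ℝ → ℝ) (r : V → ℝ) (i : V) : ℝ :=
  ∏ k ∈ Dset H p i, F (r k)

theorem SimpleGraph.Walk.exists_avoiding_of_mem_support {V : Type*} {H : SimpleGraph V} {i j x k : V}
    (hij : i ≠ j) (w : H.Walk x k) (hw : i ∈ w.support ∨ j ∈ w.support) :
    (∃ w' : H.Walk i k, j ∉ w'.support) ∨ (∃ w' : H.Walk j k, i ∉ w'.support) := by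
  induction w with
  | nil =>
    simp only [SimpleGraph.Walk.support_nil, List.mem_singleton] at hw
    rcases hw with rfl | rfl
    · exact .inl ⟨.nil, by simpa using hij.symm⟩
    · exact .inr ⟨.nil, by simpa using hij⟩
  | cons h w ih =>
    by_cases hmem : i ∈ w.support ∨ j ∈ w.support
    · exact ih hmem
    · push Not at hmem
      simp only [SimpleGraph.Walk.support_cons, List.mem_cons, hmem.1, hmem.2, or_false] at hw
      rcases hw with rfl | rfl
      · exact .inl ⟨.cons h w, by simpa using ⟨hij.symm, hmem.2⟩⟩
      · exact .inr ⟨.cons h w, by simpa using ⟨hij, hmem.1⟩⟩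

/-- The vertices leading a given reachable vertex are pairwise comparable. -/
theorem Leads.comparable {V : Type*} {H : SimpleGraph V} {p i j k : V}
    (hk : Nonempty (H.Walk p k)) (hij : i ≠ j) (hik : Leads H p i k) (hjk : Leads H p j k) :
    Leads H p i j ∨ Leads H p j i := by
  by_contra! hcon
  obtain ⟨hnij, hnji⟩ := hcon
  simp only [Leads, hij, hij.symm, ne_eq, not_false_eq_true, true_and, not_forall] at hnij hnji
  obtain ⟨a, ha⟩ := hnij
  obtain ⟨b, hb⟩ := hnji
  obtain ⟨w⟩ := hk
  rcases w.exists_avoiding_of_mem_support hij (.inl (hik.2 w)) with ⟨v, hv⟩ | ⟨v, hv⟩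
  · have := hjk.2 (b.append v)
    rw [SimpleGraph.Walk.mem_support_append_iff] at this
    exact this.elim hb hv
  · have := hik.2 (a.append v)
    rw [SimpleGraph.Walk.mem_support_append_iff] at this
    exact this.elim ha hv

theorem Leads.trans {V : Type*} [DecidableEq V] {H : SimpleGraph V} {p i k m : V}
    (him : i ≠ m) (hik : Leads H p i k) (hkm : Leads H p k m) : Leads H p i m :=
  ⟨him, fun w => w.support_takeUntil_subset_support (hkm.2 w) (hik.2 _)⟩

theorem mem_agents {V : Type*} [Fintype V] [DecidableEq V] {p x : V} :
    x ∈ agents p ↔ x ≠ p := by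
  simp [agents]

theorem mem_Dset {V : Type*} [Fintype V] [DecidableEq V] {H : SimpleGraph V} {p i x : V} :
    x ∈ Dset H p i ↔ x ∈ agents p ∧ Leads H p i x := by
  simp [Dset]

theorem mem_Pset {V : Type*} [Fintype V] [DecidableEq V] {H : SimpleGraph V} {p i x : V} :
    x ∈ Pset H p i ↔ x ∈ agents p ∧ x ≠ i ∧ ¬ Leads H p i x := by
  simp only [Pset, Finset.mem_sdiff, Finset.mem_insert, mem_Dset]
  tauto

theorem Pset_subset_of_leads {V : Type*} [Fintype V] [DecidableEq V] {H : SimpleGraph V}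
    {p i k : V} (hik : Leads H p i k) : Pset H p i ⊆ Pset H p k := by
  intro x hx
  rw [mem_Pset] at hx ⊢
  refine ⟨hx.1, ?_, fun hkx => hx.2.2 (hik.trans hx.2.1.symm hkx)⟩
  rintro rfl
  exact hx.2.2 hik

/-- For non-comparable agents, the competitors of `i` consist of `j`, the agents led by `j`, and
the agents in neither group. -/
theorem prod_Pset_of_not_comparable {V : Type*} [Fintype V] [DecidableEq V] {H : SimpleGraph V}
    {p i j : V} (hreach : ∀ v : V, Nonempty (H.Walk p v)) (hj : j ∈ agents p) (hij : i ≠ j)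
    (hnij : ¬ Leads H p i j) (hnji : ¬ Leads H p j i) (f : V → ℝ) :
    ∏ k ∈ Pset H p i, f k =
      (∏ k ∈ Pset H p i ∩ Pset H p j, f k) * (f j * ∏ k ∈ Dset H p j, f k) := by
  have hsub : insert j (Dset H p j) ⊆ Pset H p i := by
    intro x hx
    rw [Finset.mem_insert, mem_Dset] at hx
    rw [mem_Pset]
    rcases hx with rfl | ⟨hx, hjx⟩
    · exact ⟨hj, hij.symm, hnij⟩
    · refine ⟨hx, ?_, fun hix => ?_⟩
      · rintro rfl
        exact hnji hjx
      · exact (Leads.comparable (hreach x) hij hix hjx).elim hnij hnji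
  have hnot : j ∉ Dset H p j := fun h => (mem_Dset.1 h).2.1 rfl
  have heq : Pset H p i \ insert j (Dset H p j) = Pset H p i ∩ Pset H p j := by
    ext x
    simp only [Finset.mem_sdiff, Finset.mem_inter, Finset.mem_insert, mem_Pset, mem_Dset]
    tauto
  rw [← Finset.prod_sdiff hsub, heq, Finset.prod_insert hnot]

theorem mem_Icc_zero_one_of_strictMonoOn {l u : ℝ} {F : ℝ → ℝ}
    (hFmono : StrictMonoOn F (Set.Icc l u)) (hFl : F l = 0) (hFu : F u = 1) {x : ℝ}
    (hx : x ∈ Set.Icc l u) : F x ∈ Set.Icc 0 1 := by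
  have hlu : l ≤ u := hx.1.trans hx.2
  rw [← hFl, ← hFu]
  exact ⟨hFmono.monotoneOn ⟨le_rfl, hlu⟩ hx hx.1, hFmono.monotoneOn hx ⟨hlu, le_rfl⟩ hx.2⟩

/-- Thresholds weakly increase from a leader to the agents she leads. -/
theorem IsEqm.le_of_leads {V : Type*} [Fintype V] [DecidableEq V] {H : SimpleGraph V} {p : V}
    {l u c M : ℝ} (hM : 0 ≤ M) {F : ℝ → ℝ}
    (hF : ∀ x ∈ Set.Icc l u, F x ∈ Set.Icc 0 1) {r : V → ℝ} (heqm : IsEqm H p l u c M F r)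
    {i k : V} (hi : i ∈ agents p) (hk : k ∈ agents p) (hik : Leads H p i k) : r i ≤ r k := by
  obtain ⟨hr, hpos, hthr⟩ := heqm
  by_contra! hlt
  have hmem : ∀ m ∈ agents p, F (max (r m) (r i)) ∈ Set.Icc 0 1 := fun m hm =>
    hF _ ⟨(hr m hm).1.trans (le_max_left _ _), max_le (hr m hm).2 (hr i hi).2⟩
  have hagents : ∀ {a m}, m ∈ Pset H p a → m ∈ agents p := fun hm => (mem_Pset.1 hm).1
  have hle : ∏ m ∈ Pset H p k, F (max (r m) (r i)) ≤ ∏ m ∈ Pset H p i, F (max (r m) (r i)) := by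
    rw [← Finset.prod_sdiff (Pset_subset_of_leads hik)]
    refine mul_le_of_le_one_left
      (Finset.prod_nonneg fun m hm => (hmem m (hagents hm)).1)
      (Finset.prod_le_one (fun m hm => ?_) fun m hm => ?_)
    · exact (hmem m (hagents (Finset.mem_sdiff.1 hm).1)).1
    · exact (hmem m (hagents (Finset.mem_sdiff.1 hm).1)).2
  have hk_pos := hpos k hk (r i) ⟨hlt, (hr i hi).2⟩
  have hmul := mul_le_mul_of_nonneg_left hle hM
  rcases hthr i hi with h | h
  · exact absurd (hr k hk).1 (by linarith)
  · unfold piU at hk_pos h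
    linarith

theorem continuousOn_piU {V : Type*} [Fintype V] [DecidableEq V] (H : SimpleGraph V) (p : V)
    {l u : ℝ} (c M : ℝ) {F : ℝ → ℝ} (hFcont : ContinuousOn F (Set.Icc l u)) {r : V → ℝ}
    (hr : ∀ i ∈ agents p, r i ∈ Set.Icc l u) (i : V) :
    ContinuousOn (piU H p c M F r i) (Set.Icc l u) := by
  unfold piU
  refine (continuousOn_const.mul (continuousOn_finsetProd _ fun k hk => ?_)).sub continuousOn_const
  have hk' := hr k (mem_Pset.1 hk).1
  exact hFcont.comp (by fun_prop) fun q hq =>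
    ⟨hq.1.trans (le_max_right _ _), max_le hk'.2 hq.2⟩

/-- By continuity, contributing with an ability weakly above the threshold and below `u` is not
harmful. -/
theorem IsEqm.piU_nonneg {V : Type*} [Fintype V] [DecidableEq V] {H : SimpleGraph V} {p : V}
    {l u c M : ℝ} {F : ℝ → ℝ} (hFcont : ContinuousOn F (Set.Icc l u)) {r : V → ℝ}
    (heqm : IsEqm H p l u c M F r) {i : V} (hi : i ∈ agents p) {q : ℝ} (hq : q ∈ Set.Ico (r i) u) :
    0 ≤ piU H p c M F r i q := by
  have hl : l ≤ q := (heqm.1 i hi).1.trans hq.1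
  have hcont := (continuousOn_piU H p c M hFcont heqm.1 i) q ⟨hl, hq.2.le⟩
  have hmem : q ∈ closure (Set.Ioc q u) := by
    rw [closure_Ioc hq.2.ne]
    exact ⟨le_rfl, hq.2.le⟩
  have := mem_closure_iff_nhdsWithin_neBot.1 hmem
  refine ge_of_tendsto (hcont.mono fun x hx => ⟨hl.trans hx.1.le, hx.2⟩ :
    ContinuousWithinAt _ (Set.Ioc q u) q) ?_
  filter_upwards [self_mem_nhdsWithin] with x hx
  exact (heqm.2.1 i hi x ⟨hq.1.trans_lt hx.1, hx.2⟩).le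

/-- Strict monotonicity of thresholds in the leader-of-mediocre probability for
non-comparable agents (Lemma 4). -/
theorem lom_lt_of_not_comparable {V : Type*} [Fintype V] [DecidableEq V]
    (H : SimpleGraph V) (p : V) (hreach : ∀ v : V, Nonempty (H.Walk p v))
    (l u c M : ℝ) (hlu : l < u) (hc : 0 < c) (hcM : c < M)
    (F : ℝ → ℝ) (hFcont : ContinuousOn F (Set.Icc l u))
    (hFmono : StrictMonoOn F (Set.Icc l u)) (hFl : F l = 0) (hFu : F u = 1)
    (r : V → ℝ) (heqm : IsEqm H p l u c M F r)
    (i j : V) (hi : i ∈ agents p) (hj : j ∈ agents p) (hij : i ≠ j)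
    (hnij : ¬ Leads H p i j) (hnji : ¬ Leads H p j i)
    (hlom : lom H p F r i < lom H p F r j) :
    r i < r j := by
  have hM : 0 < M := hc.trans hcM
  have hF : ∀ x ∈ Set.Icc l u, F x ∈ Set.Icc 0 1 := fun x hx =>
    mem_Icc_zero_one_of_strictMonoOn hFmono hFl hFu hx
  have hr := heqm.1
  by_contra! hji
  have hmax : ∀ m ∈ agents p, max (r m) (r i) ∈ Set.Icc l u := fun m hm =>
    ⟨(hr m hm).1.trans (le_max_left _ _), max_le (hr m hm).2 (hr i hi).2⟩
  have hiu : r i < u := by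
    refine lt_of_le_of_ne (hr i hi).2 fun h => ?_
    rcases heqm.2.2 i hi with h' | h'
    · exact hlu.ne (h'.symm.trans h)
    · have : ∏ k ∈ Pset H p i, F (max (r k) (r i)) = 1 := Finset.prod_eq_one fun k hk => by
        rw [max_eq_right (h ▸ (hr k (mem_Pset.1 hk).1).2), h, hFu]
      rw [piU, this] at h'
      linarith
  have hj_nonneg := heqm.piU_nonneg hFcont hj ⟨hji, hiu⟩
  have hlom_i : ∏ k ∈ Dset H p i, F (max (r k) (r i)) = lom H p F r i := by
    refine Finset.prod_congr rfl fun k hk => ?_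
    obtain ⟨hk, hik⟩ := mem_Dset.1 hk
    rw [max_eq_left (heqm.le_of_leads hM.le hF hi hk hik)]
  have hlom_j : lom H p F r j ≤ ∏ k ∈ Dset H p j, F (max (r k) (r i)) := by
    refine Finset.prod_le_prod (fun k hk => ?_) fun k hk => ?_
    · exact (hF _ (hr k (mem_Dset.1 hk).1)).1
    · have hk := (mem_Dset.1 hk).1
      exact hFmono.monotoneOn (hr k hk) (hmax k hk) (le_max_left _ _)
  have hi_thr := heqm.2.2 i hi
  have hlom_nonneg : 0 ≤ lom H p F r i :=
    Finset.prod_nonneg fun k hk => (hF _ (hr k (mem_Dset.1 hk).1)).1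
  rw [piU, prod_Pset_of_not_comparable hreach hj hij hnij hnji, max_eq_right hji] at hi_thr
  rw [piU, prod_Pset_of_not_comparable hreach hi hij.symm hnji hnij, max_self, hlom_i,
    Finset.inter_comm] at hj_nonneg
  have hW : 0 ≤ ∏ k ∈ Pset H p i ∩ Pset H p j, F (max (r k) (r i)) :=
    Finset.prod_nonneg fun k hk => (hF _ (hmax k (mem_Pset.1 (Finset.mem_inter.1 hk).1).1)).1
  have hFi := (hF _ (hr i hi)).1
  generalize ∏ k ∈ Pset H p i ∩ Pset H p j, F (max (r k) (r i)) = W at *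
  generalize ∏ k ∈ Dset H p j, F (max (r k) (r i)) = B at *
  have hA : 0 < M * (W * F (r i)) := by
    refine lt_of_le_of_ne (by positivity) fun h => ?_
    have : M * (W * (F (r i) * lom H p F r i)) = M * (W * F (r i)) * lom H p F r i := by ring
    rw [this, ← h] at hj_nonneg
    linarith
  rcases hi_thr with h | h
  · rw [h, hFl] at hA
    simp at hA
  · have := mul_lt_mul_of_pos_left (hlom.trans_le hlom_j) hA
    linarith
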